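/- arXiv:1003.3539 — 4 statements merged into one kernel-verified Lean document; each statement's English description precedes it below -/
import Mathlib

section
/- Let ρ₁, ρ₂, θ₀ ∈ ℝ, let h, f : ℝ → ℝ be continuous with f nonnegative, and assume x ↦ h(x)²·f(x) is Lebesgue integrable on ℝ. Define K(θ) = ∫_ℝ (ρ₁·x·(1_{x < θ} − 1_{x < θ₀}) + ρ₂·x·(1_{x ≥ θ} − 1_{x ≥ θ₀}) + h(x))²·f(x) dx. Then for every θ > θ₀, K is differentiable at θ with K′(θ) = ((ρ₁ − ρ₂)²·θ² + 2(ρ₁ − ρ₂)·θ·h(θ))·f(θ). -/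
open MeasureTheory

/-- For `θ₀ ≤ θ`, the integrand differs from `h² f` only on `[θ₀, θ)`. -/
lemma threshold_integrand_eq (ρ₁ ρ₂ θ₀ θ : ℝ) (h f : ℝ → ℝ) (hθ : θ₀ ≤ θ) (x : ℝ) :
    (ρ₁ * x * ((if x < θ then (1 : ℝ) else 0) - (if x < θ₀ then (1 : ℝ) else 0))
          + ρ₂ * x * ((if θ ≤ x then (1 : ℝ) else 0) - (if θ₀ ≤ x then (1 : ℝ) else 0))
          + h x) ^ 2 * f x =
      (h x) ^ 2 * f x + (Set.Ico θ₀ θ).indicator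
        (fun y => ((ρ₁ - ρ₂) ^ 2 * y ^ 2 + 2 * (ρ₁ - ρ₂) * y * h y) * f y) x := by
  rcases lt_or_ge x θ₀ with h₀ | h₀
  · simp [h₀, h₀.trans_le hθ, h₀.not_ge, (h₀.trans_le hθ).not_ge]
  · rcases lt_or_ge x θ with h₁ | h₁
    · simp only [h₀, h₁, h₀.not_gt, h₁.not_ge, if_true, if_false, Set.mem_Ico, and_self,
        Set.indicator_of_mem]
      ring
    · simp [h₀, h₁, h₀.not_gt, h₁.not_gt]

/-- Differentiability of the Kullback–Leibler distance `K(θ)` of the contaminated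
threshold Ornstein–Uhlenbeck model for `θ > θ₀`, with derivative
`((ρ₁ − ρ₂)²θ² + 2(ρ₁ − ρ₂)θ h(θ)) f(θ)`. -/
theorem stmt3 (ρ₁ ρ₂ θ₀ : ℝ) (h f : ℝ → ℝ) (hh : Continuous h) (hf : Continuous f)
    (hf_nonneg : ∀ x, 0 ≤ f x)
    (hint : Integrable (fun x => (h x) ^ 2 * f x))
    (θ : ℝ) (hθ : θ₀ < θ) :
    HasDerivAt
      (fun θ' => ∫ x,
        (ρ₁ * x * ((if x < θ' then (1 : ℝ) else 0) - (if x < θ₀ then (1 : ℝ) else 0))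
          + ρ₂ * x * ((if θ' ≤ x then (1 : ℝ) else 0) - (if θ₀ ≤ x then (1 : ℝ) else 0))
          + h x) ^ 2 * f x)
      (((ρ₁ - ρ₂) ^ 2 * θ ^ 2 + 2 * (ρ₁ - ρ₂) * θ * h θ) * f θ) θ := by
  set g : ℝ → ℝ := fun y =>
    ((ρ₁ - ρ₂) ^ 2 * y ^ 2 + 2 * (ρ₁ - ρ₂) * y * h y) * f y with hg
  have hgc : Continuous g := by fun_prop
  have hderiv : HasDerivAt
      (fun θ' => (∫ x, (h x) ^ 2 * f x) + ∫ x in θ₀..θ', g x) (g θ) θ :=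
    (intervalIntegral.integral_hasDerivAt_right (hgc.intervalIntegrable _ _)
      hgc.aestronglyMeasurable.stronglyMeasurableAtFilter hgc.continuousAt).const_add _
  refine hderiv.congr_of_eventuallyEq ?_
  filter_upwards [lt_mem_nhds hθ] with θ' hθ'
  have hgi : Integrable ((Set.Ico θ₀ θ').indicator g) :=
    (hgc.continuousOn.integrableOn_Icc.mono_set Set.Ico_subset_Icc_self).integrable_indicator
      measurableSet_Ico
  simp_rw [threshold_integrand_eq ρ₁ ρ₂ θ₀ θ' h f hθ'.le]
  rw [integral_add hint hgi, integral_indicator measurableSet_Ico,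
    intervalIntegral.integral_of_le hθ'.le, integral_Ico_eq_integral_Ioo,
    integral_Ioc_eq_integral_Ioo]
end

section
/- Let ρ₁, ρ₂, θ₀ ∈ ℝ, let h, f : ℝ → ℝ be continuous with f nonnegative, and assume x ↦ h(x)²·f(x) is Lebesgue integrable on ℝ. Define K(θ) = ∫_ℝ (ρ₁·x·(1_{x < θ} − 1_{x < θ₀}) + ρ₂·x·(1_{x ≥ θ} − 1_{x ≥ θ₀}) + h(x))²·f(x) dx. Then for every θ < θ₀, K is differentiable at θ with K′(θ) = −((ρ₂ − ρ₁)²·θ² + 2(ρ₂ − ρ₁)·θ·h(θ))·f(θ). -/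
open MeasureTheory

/-- Differentiability of the Kullback–Leibler distance `K(θ)` of the contaminated
threshold Ornstein–Uhlenbeck model for `θ < θ₀`, with derivative
`−((ρ₂ − ρ₁)²θ² + 2(ρ₂ − ρ₁)θ h(θ)) f(θ)`. -/
theorem stmt4 (ρ₁ ρ₂ θ₀ : ℝ) (h f : ℝ → ℝ) (hh : Continuous h) (hf : Continuous f)
    (hf_nonneg : ∀ x, 0 ≤ f x)
    (hint : Integrable (fun x => (h x) ^ 2 * f x))
    (θ : ℝ) (hθ : θ < θ₀) :
    HasDerivAt
      (fun θ' => ∫ x,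
        (ρ₁ * x * ((if x < θ' then (1 : ℝ) else 0) - (if x < θ₀ then (1 : ℝ) else 0))
          + ρ₂ * x * ((if θ' ≤ x then (1 : ℝ) else 0) - (if θ₀ ≤ x then (1 : ℝ) else 0))
          + h x) ^ 2 * f x)
      (-((ρ₂ - ρ₁) ^ 2 * θ ^ 2 + 2 * (ρ₂ - ρ₁) * θ * h θ) * f θ) θ := by
  set g : ℝ → ℝ := fun x => ((ρ₂ - ρ₁) ^ 2 * x ^ 2 + 2 * (ρ₂ - ρ₁) * x * h x) * f x with hg
  have hgc : Continuous g := by fun_prop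
  have hderiv : HasDerivAt (fun θ' => (∫ x, (h x) ^ 2 * f x) + ∫ x in θ'..θ₀, g x) (-g θ) θ :=
    (intervalIntegral.integral_hasDerivAt_left (hgc.intervalIntegrable θ θ₀)
      (hgc.stronglyMeasurableAtFilter _ _) hgc.continuousAt).const_add _
  have hval : -((ρ₂ - ρ₁) ^ 2 * θ ^ 2 + 2 * (ρ₂ - ρ₁) * θ * h θ) * f θ = -g θ := by
    simp only [hg]
    ring
  rw [hval]
  refine hderiv.congr_of_eventuallyEq ?_
  filter_upwards [Iio_mem_nhds hθ] with t ht
  have htθ : t < θ₀ := ht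
  have hgi : Integrable ((Set.Ico t θ₀).indicator g) :=
    ((hgc.integrableOn_Icc (a := t) (b := θ₀)).mono_set Set.Ico_subset_Icc_self).integrable_indicator
      measurableSet_Ico
  rw [intervalIntegral.integral_of_le htθ.le, ← integral_Ico_eq_integral_Ioc,
    ← integral_indicator measurableSet_Ico, ← integral_add hint hgi]
  congr 1 with x
  rcases lt_or_ge x t with h1 | h1
  · have h2 : x < θ₀ := h1.trans htθ
    simp [h1, h2, h1.not_ge, h2.not_ge]
  · rcases lt_or_ge x θ₀ with h2 | h2
    · simp only [h1, h2, h1.not_gt, h2.not_ge, hg, Set.indicator, Set.mem_Ico, and_self, if_true,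
        if_false]
      ring
    · simp [h1, h2, h1.not_gt, h2.not_gt]
end

section
/- Let 0 < α < β, ρ₂ > ρ₁, θ₀ ∈ (α, β). Let h, f : ℝ → ℝ be continuous with f strictly positive on [α, β] and nonnegative on ℝ, assume x ↦ h(x)²·f(x) is Lebesgue integrable on ℝ, and assume |h(y)| < (y/2)·(ρ₂ − ρ₁) for all y ∈ (α, β). Define K(θ) = ∫_ℝ (ρ₁·x·(1_{x < θ} − 1_{x < θ₀}) + ρ₂·x·(1_{x ≥ θ} − 1_{x ≥ θ₀}) + h(x))²·f(x) dx. Then K is strictly increasing on [θ₀, β) and strictly decreasing on (α, θ₀]. -/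
open MeasureTheory

theorem integral_lt_integral_of_lt_on_Ioo {F G : ℝ → ℝ} {a b : ℝ} (hab : a < b)
    (hF : Integrable F) (hG : Integrable G) (hle : F ≤ G)
    (hlt : ∀ x ∈ Set.Ioo a b, F x < G x) : ∫ x, F x < ∫ x, G x := by
  have hpos : 0 < ∫ x, (G x - F x) := by
    rw [integral_pos_iff_support_of_nonneg (fun x => sub_nonneg.2 (hle x)) (hG.sub hF)]
    refine lt_of_lt_of_le ?_ (measure_mono (s := Set.Ioo a b) fun x hx => ?_)
    · simpa using hab
    · exact (sub_pos.2 (hlt x hx)).ne'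
  rw [integral_sub hG hF] at hpos
  linarith

/-- The integrand defining the Kullback–Leibler distance at threshold `θ`. -/
noncomputable def klIntegrand (ρ₁ ρ₂ θ₀ : ℝ) (h f : ℝ → ℝ) (θ x : ℝ) : ℝ :=
  (ρ₁ * x * ((if x < θ then (1 : ℝ) else 0) - (if x < θ₀ then (1 : ℝ) else 0))
    + ρ₂ * x * ((if θ ≤ x then (1 : ℝ) else 0) - (if θ₀ ≤ x then (1 : ℝ) else 0))
    + h x) ^ 2 * f x

section klIntegrand

variable {ρ₁ ρ₂ θ₀ θ x : ℝ} {h f : ℝ → ℝ}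

theorem klIntegrand_of_iff (hx : x < θ ↔ x < θ₀) :
    klIntegrand ρ₁ ρ₂ θ₀ h f θ x = h x ^ 2 * f x := by
  have hx' : θ ≤ x ↔ θ₀ ≤ x := by simpa using not_congr hx
  simp [klIntegrand, hx, hx']

theorem klIntegrand_eq_of_notMem_Ico {a b : ℝ} (hab : a ≤ b) (hx : x ∉ Set.Ico a b) :
    klIntegrand ρ₁ ρ₂ θ₀ h f a x = klIntegrand ρ₁ ρ₂ θ₀ h f b x := by
  have h₁ : x < a ↔ x < b :=
    ⟨fun h => h.trans_le hab, fun h => by by_contra! h'; exact hx ⟨h', h⟩⟩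
  have h₂ : a ≤ x ↔ b ≤ x := by simpa using not_congr h₁
  simp only [klIntegrand, h₁, h₂]

theorem klIntegrand_of_mem_Ico_left (hx : x ∈ Set.Ico θ₀ θ) :
    klIntegrand ρ₁ ρ₂ θ₀ h f θ x = (h x - (ρ₂ - ρ₁) * x) ^ 2 * f x := by
  simp only [klIntegrand, if_pos hx.1, if_pos hx.2, if_neg hx.1.not_gt, if_neg hx.2.not_ge]
  ring

theorem klIntegrand_of_mem_Ico_right (hx : x ∈ Set.Ico θ θ₀) :
    klIntegrand ρ₁ ρ₂ θ₀ h f θ x = (h x + (ρ₂ - ρ₁) * x) ^ 2 * f x := by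
  simp only [klIntegrand, if_pos hx.1, if_pos hx.2, if_neg hx.1.not_gt, if_neg hx.2.not_ge]
  ring

theorem integrable_klIntegrand (hh : Continuous h) (hf : Continuous f)
    (hint : Integrable (fun x => h x ^ 2 * f x)) :
    Integrable (klIntegrand ρ₁ ρ₂ θ₀ h f θ) := by
  have key : ∀ (a b : ℝ) (u : ℝ → ℝ), Continuous u → Integrable ((Set.Ico a b).indicator u) :=
    fun a b u hu => (integrable_indicator_iff measurableSet_Ico).2
      (hu.integrableOn_Icc.mono_set Set.Ico_subset_Icc_self)
  have h₁ := key θ₀ θ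
    (fun x => (h x - (ρ₂ - ρ₁) * x) ^ 2 * f x - h x ^ 2 * f x) (by fun_prop)
  have h₂ := key θ θ₀
    (fun x => (h x + (ρ₂ - ρ₁) * x) ^ 2 * f x - h x ^ 2 * f x) (by fun_prop)
  refine ((hint.add h₁).add h₂).congr (.of_forall fun x => ?_)
  simp only [Pi.add_apply]
  by_cases hx₁ : x ∈ Set.Ico θ₀ θ
  · have hx₂ : x ∉ Set.Ico θ θ₀ := fun hx => hx.1.not_gt hx₁.2
    rw [klIntegrand_of_mem_Ico_left hx₁, Set.indicator_of_mem hx₁, Set.indicator_of_notMem hx₂]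
    ring
  · by_cases hx₂ : x ∈ Set.Ico θ θ₀
    · rw [klIntegrand_of_mem_Ico_right hx₂, Set.indicator_of_notMem hx₁,
        Set.indicator_of_mem hx₂]
      ring
    · rw [Set.indicator_of_notMem hx₁, Set.indicator_of_notMem hx₂, klIntegrand_of_iff]
      · ring
      · simp only [Set.mem_Ico, not_and, not_lt] at hx₁ hx₂
        constructor <;> intro hx <;> by_contra! hx' <;> [linarith [hx₁ hx']; linarith [hx₂ hx']]

end klIntegrand

/-- Under the contamination condition `|h(y)| < (y/2)(ρ₂ − ρ₁)` on `(α, β)`, the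
Kullback–Leibler distance `K` is strictly increasing on `[θ₀, β)` and strictly
decreasing on `(α, θ₀]`. -/
theorem stmt5 (α β ρ₁ ρ₂ θ₀ : ℝ) (hα : 0 < α) (hαβ : α < β) (hρ : ρ₁ < ρ₂)
    (hθ₀ : θ₀ ∈ Set.Ioo α β) (h f : ℝ → ℝ) (hh : Continuous h) (hf : Continuous f)
    (hf_pos : ∀ x ∈ Set.Icc α β, 0 < f x) (hf_nonneg : ∀ x, 0 ≤ f x)
    (hint : Integrable (fun x => (h x) ^ 2 * f x))
    (hcond : ∀ y ∈ Set.Ioo α β, |h y| < y / 2 * (ρ₂ - ρ₁))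
    (K : ℝ → ℝ)
    (hK : ∀ θ, K θ = ∫ x,
      (ρ₁ * x * ((if x < θ then (1 : ℝ) else 0) - (if x < θ₀ then (1 : ℝ) else 0))
        + ρ₂ * x * ((if θ ≤ x then (1 : ℝ) else 0) - (if θ₀ ≤ x then (1 : ℝ) else 0))
        + h x) ^ 2 * f x) :
    StrictMonoOn K (Set.Ico θ₀ β) ∧ StrictAntiOn K (Set.Ioc α θ₀) := by
  have hKg : ∀ θ, K θ = ∫ x, klIntegrand ρ₁ ρ₂ θ₀ h f θ x := hK
  have hI : ∀ θ, Integrable (klIntegrand ρ₁ ρ₂ θ₀ h f θ) :=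
    fun θ => integrable_klIntegrand hh hf hint
  have hlt : ∀ x ∈ Set.Ioo α β,
      h x ^ 2 * f x < (h x - (ρ₂ - ρ₁) * x) ^ 2 * f x ∧
        h x ^ 2 * f x < (h x + (ρ₂ - ρ₁) * x) ^ 2 * f x := by
    intro x hx
    have hfx := hf_pos x (Set.Ioo_subset_Icc_self hx)
    have hd : 0 < (ρ₂ - ρ₁) * x := mul_pos (sub_pos.2 hρ) (hα.trans hx.1)
    obtain ⟨hl, hr⟩ := abs_lt.1 (hcond x hx)
    constructor <;> refine mul_lt_mul_of_pos_right ?_ hfx <;> nlinarith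
  constructor
  · intro a ha b hb hab
    have hlt' : ∀ x ∈ Set.Ico a b,
        klIntegrand ρ₁ ρ₂ θ₀ h f a x < klIntegrand ρ₁ ρ₂ θ₀ h f b x := by
      intro x hx
      have hx₀ : θ₀ ≤ x := ha.1.trans hx.1
      rw [klIntegrand_of_iff (iff_of_false hx.1.not_gt hx₀.not_gt), klIntegrand_of_mem_Ico_left ⟨hx₀, hx.2⟩]
      exact (hlt x ⟨hθ₀.1.trans_le hx₀, hx.2.trans hb.2⟩).1
    rw [hKg, hKg]
    refine integral_lt_integral_of_lt_on_Ioo hab (hI a) (hI b) (fun x => ?_)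
      fun x hx => hlt' x (Set.Ioo_subset_Ico_self hx)
    by_cases hx : x ∈ Set.Ico a b
    · exact (hlt' x hx).le
    · exact (klIntegrand_eq_of_notMem_Ico hab.le hx).le
  · intro a ha b hb hab
    have hlt' : ∀ x ∈ Set.Ico a b,
        klIntegrand ρ₁ ρ₂ θ₀ h f b x < klIntegrand ρ₁ ρ₂ θ₀ h f a x := by
      intro x hx
      have hx₀ : x < θ₀ := hx.2.trans_le hb.2
      rw [klIntegrand_of_iff (iff_of_true hx.2 hx₀), klIntegrand_of_mem_Ico_right ⟨hx.1, hx₀⟩]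
      exact (hlt x ⟨ha.1.trans_le hx.1, hx₀.trans hθ₀.2⟩).2
    rw [hKg, hKg]
    refine integral_lt_integral_of_lt_on_Ioo hab (hI b) (hI a) (fun x => ?_)
      fun x hx => hlt' x (Set.Ioo_subset_Ico_self hx)
    by_cases hx : x ∈ Set.Ico a b
    · exact (hlt' x hx).le
    · exact (klIntegrand_eq_of_notMem_Ico hab.le hx).ge
end

section
/- Let 0 < α < β, ρ₂ > ρ₁, θ₀ ∈ (α, β). Let h, f : ℝ → ℝ be continuous with f strictly positive on [α, β] and nonnegative on ℝ, assume x ↦ h(x)²·f(x) is Lebesgue integrable on ℝ, and assume |h(y)| < (y/2)·(ρ₂ − ρ₁) for all y ∈ (α, β). Define K(θ) = ∫_ℝ (ρ₁·x·(1_{x < θ} − 1_{x < θ₀}) + ρ₂·x·(1_{x ≥ θ} − 1_{x ≥ θ₀}) + h(x))²·f(x) dx. Then θ₀ is the unique minimizer of K on (α, β): for every θ ∈ (α, β) with θ ≠ θ₀ one has K(θ) > K(θ₀). (Consequently the maximum likelihood estimator of the threshold computed under the misspecified model without contamination h is nevertheless consistent.) -/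
open MeasureTheory

/-- Adding to an integrable function a continuous function that is positive on `(a, b)`,
cut off to `[a, b)`, strictly increases its integral. -/
theorem integral_lt_integral_add_indicator_Ico {φ G : ℝ → ℝ} {a b : ℝ} (hab : a < b)
    (hφ : Integrable φ) (hG : Continuous G) (hpos : ∀ x ∈ Set.Ioo a b, 0 < G x) :
    ∫ x, φ x < ∫ x, (φ x + (Set.Ico a b).indicator G x) := by
  have hGi : IntegrableOn G (Set.Ico a b) :=
    (hG.integrableOn_Icc (a := a) (b := b)).mono_set Set.Ico_subset_Icc_self
  rw [integral_add hφ (hGi.integrable_indicator measurableSet_Ico),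
    integral_indicator measurableSet_Ico, integral_Ico_eq_integral_Ioc,
    ← intervalIntegral.integral_of_le hab.le]
  have := intervalIntegral.intervalIntegral_pos_of_pos_on (hG.intervalIntegrable a b) hpos hab
  linarith

/-- Under the contamination condition `|h(y)| < (y/2)(ρ₂ − ρ₁)` on `(α, β)`, the true
threshold `θ₀` is the unique minimizer of the Kullback–Leibler distance `K` on `(α, β)`,
so that the misspecified maximum likelihood estimator of the threshold is consistent. -/
theorem stmt6 (α β ρ₁ ρ₂ θ₀ : ℝ) (hα : 0 < α) (hαβ : α < β) (hρ : ρ₁ < ρ₂)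
    (hθ₀ : θ₀ ∈ Set.Ioo α β) (h f : ℝ → ℝ) (hh : Continuous h) (hf : Continuous f)
    (hf_pos : ∀ x ∈ Set.Icc α β, 0 < f x) (hf_nonneg : ∀ x, 0 ≤ f x)
    (hint : Integrable (fun x => (h x) ^ 2 * f x))
    (hcond : ∀ y ∈ Set.Ioo α β, |h y| < y / 2 * (ρ₂ - ρ₁))
    (K : ℝ → ℝ)
    (hK : ∀ θ, K θ = ∫ x,
      (ρ₁ * x * ((if x < θ then (1 : ℝ) else 0) - (if x < θ₀ then (1 : ℝ) else 0))
        + ρ₂ * x * ((if θ ≤ x then (1 : ℝ) else 0) - (if θ₀ ≤ x then (1 : ℝ) else 0))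
        + h x) ^ 2 * f x) :
    ∀ θ ∈ Set.Ioo α β, θ ≠ θ₀ → K θ₀ < K θ := by
  intro θ hθ hne
  have hc : 0 < ρ₂ - ρ₁ := sub_pos.2 hρ
  have hK₀ : K θ₀ = ∫ x, (h x) ^ 2 * f x := by
    rw [hK]
    simp
  rw [hK₀, hK θ]
  rcases hne.lt_or_gt with hlt | hlt
  · have key := integral_lt_integral_add_indicator_Ico
      (G := fun x => (ρ₂ - ρ₁) * x * ((ρ₂ - ρ₁) * x + 2 * h x) * f x) hlt hint
      (by fun_prop) (by
        intro x hx
        have hx' : x ∈ Set.Ioo α β := ⟨hθ.1.trans hx.1, hx.2.trans hθ₀.2⟩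
        have h₁ := (abs_lt.1 (hcond x hx')).1
        have h₂ : 0 < (ρ₂ - ρ₁) * x + 2 * h x := by linarith
        have h₃ := hf_pos x ⟨hx'.1.le, hx'.2.le⟩
        have h₄ : 0 < x := hα.trans hx'.1
        positivity)
    refine key.trans_eq (integral_congr_ae (Filter.Eventually.of_forall fun x => ?_))
    by_cases h₁ : x < θ
    · simp [h₁, h₁.trans hlt, h₁.not_ge, (h₁.trans hlt).not_ge]
    · by_cases h₂ : x < θ₀
      · simp [h₁, h₂, h₂.not_ge, not_lt.1 h₁]
        ring
      · simp [h₁, h₂, not_lt.1 h₁, not_lt.1 h₂]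
  · have key := integral_lt_integral_add_indicator_Ico
      (G := fun x => (ρ₂ - ρ₁) * x * ((ρ₂ - ρ₁) * x - 2 * h x) * f x) hlt hint
      (by fun_prop) (by
        intro x hx
        have hx' : x ∈ Set.Ioo α β := ⟨hθ₀.1.trans hx.1, hx.2.trans hθ.2⟩
        have h₁ := (abs_lt.1 (hcond x hx')).2
        have h₂ : 0 < (ρ₂ - ρ₁) * x - 2 * h x := by linarith
        have h₃ := hf_pos x ⟨hx'.1.le, hx'.2.le⟩
        have h₄ : 0 < x := hα.trans hx'.1
        positivity)
    refine key.trans_eq (integral_congr_ae (Filter.Eventually.of_forall fun x => ?_))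
    by_cases h₁ : x < θ₀
    · simp [h₁, h₁.trans hlt, h₁.not_ge, (h₁.trans hlt).not_ge]
    · by_cases h₂ : x < θ
      · simp [h₁, h₂, h₂.not_ge, not_lt.1 h₁]
        ring
      · simp [h₁, h₂, not_lt.1 h₁, not_lt.1 h₂]
end
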